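/- Fix an integer K ≥ 2 and a real η with 0 < η ≤ 1/162. Let x' ∈ Δ_K have all coordinates positive and let b₁, b₂ ∈ ℝ^K. Suppose x ∈ Δ_K has all coordinates positive and minimizes ⟨·, b₁⟩ + D_ψ(·, x') over Δ_K points with positive coordinates, and y ∈ Δ_K has all coordinates positive and minimizes ⟨·, b₂⟩ + D_ψ(·, x') over Δ_K points with positive coordinates. If ‖b₂ − b₁‖_{∇⁻²ψ(x)} ≤ 1/9, then ⟨x − y, b₂ − b₁⟩ ≤ 3·‖b₂ − b₁‖²_{∇⁻²ψ(x)}. -/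

import Mathlib

open Finset

/-- The probability simplex over `K` arms, restricted to strictly positive coordinates. -/
def posSimplex (K : ℕ) (x : Fin K → ℝ) : Prop :=
  (∀ i, 0 < x i) ∧ ∑ i, x i = 1

/-- The hybrid regularizer `ψ(x) = (1/η)·∑ᵢ ln(1/xᵢ) + (K/η)·∑ᵢ xᵢ ln xᵢ`. -/
noncomputable def hybridPsi (K : ℕ) (η : ℝ) (x : Fin K → ℝ) : ℝ :=
  (1 / η) * ∑ i, Real.log (1 / x i) + ((K : ℝ) / η) * ∑ i, x i * Real.log (x i)

/-- The gradient of the hybrid regularizer. -/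
noncomputable def hybridGradPsi (K : ℕ) (η : ℝ) (y : Fin K → ℝ) (i : Fin K) : ℝ :=
  (1 / η) * (-(1 / y i)) + ((K : ℝ) / η) * (Real.log (y i) + 1)

/-- The Bregman divergence `D_ψ(x, y) = ψ(x) − ψ(y) − ⟨∇ψ(y), x − y⟩` of the
hybrid regularizer. -/
noncomputable def hybridBreg (K : ℕ) (η : ℝ) (x y : Fin K → ℝ) : ℝ :=
  hybridPsi K η x - hybridPsi K η y - ∑ i, hybridGradPsi K η y i * (x i - y i)

/-- The `i`-th diagonal entry `hᵢ(x) = (1/η)(1/xᵢ² + K/xᵢ)` of the Hessian `∇²ψ(x)`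
of the hybrid regularizer. -/
noncomputable def hybridHess (K : ℕ) (η : ℝ) (x : Fin K → ℝ) (i : Fin K) : ℝ :=
  (1 / η) * (1 / (x i) ^ 2 + (K : ℝ) / x i)

/-- Squared local norm `‖v‖²_{∇²ψ(x)} = ∑ᵢ hᵢ(x)·vᵢ²`. -/
noncomputable def hessNormSq (K : ℕ) (η : ℝ) (x v : Fin K → ℝ) : ℝ :=
  ∑ i, hybridHess K η x i * (v i) ^ 2

/-- Squared dual local norm `‖v‖²_{∇⁻²ψ(x)} = ∑ᵢ vᵢ²/hᵢ(x)`. -/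
noncomputable def invHessNormSq (K : ℕ) (η : ℝ) (x v : Fin K → ℝ) : ℝ :=
  ∑ i, (v i) ^ 2 / hybridHess K η x i

/-- The importance-weighted optimistic estimator `ℓ̂` built from loss `ℓ`, optimistic
prediction `m`, played arm `j`, and sampling distribution `w`:
`ℓ̂ⱼ = (ℓⱼ − mⱼ)/wⱼ + mⱼ` and `ℓ̂ᵢ = mᵢ` for `i ≠ j`. -/
noncomputable def iwEstimator (K : ℕ) (ℓ m : Fin K → ℝ) (j : Fin K) (w : Fin K → ℝ)
    (i : Fin K) : ℝ :=
  if i = j then (ℓ j - m j) / w j + m j else m i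

/-- Along a line, the mirror-descent objective has the expected directional derivative. -/
theorem hasDerivAt_linear_add_hybridBreg (K : ℕ) (η : ℝ) (b x' x d : Fin K → ℝ)
    (hx : ∀ i, 0 < x i) :
    HasDerivAt (fun t : ℝ => (∑ i, (x i + t * d i) * b i) +
        hybridBreg K η (fun i => x i + t * d i) x')
      (∑ i, d i * (b i + hybridGradPsi K η x i - hybridGradPsi K η x' i)) 0 := by
  have hline (i : Fin K) : HasDerivAt (fun t : ℝ => x i + t * d i) (d i) 0 := by
    simpa using ((hasDerivAt_id (0 : ℝ)).mul_const (d i)).const_add (x i)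
  have hlog (i : Fin K) : HasDerivAt (fun t : ℝ => Real.log (x i + t * d i)) (d i / x i) 0 := by
    simpa using (hline i).log (by simpa using (hx i).ne')
  have hlin := HasDerivAt.fun_sum (u := univ) fun i _ => (hline i).mul_const (b i)
  have hbar := (HasDerivAt.fun_sum (u := univ) fun i _ => (hlog i).neg).const_mul (1 / η)
  have hent := (HasDerivAt.fun_sum (u := univ) fun i _ => (hline i).mul (hlog i)).const_mul
    ((K : ℝ) / η)
  have hgrad := HasDerivAt.fun_sum (u := univ) fun i _ =>
    ((hline i).sub_const (x' i)).const_mul (hybridGradPsi K η x' i)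
  have key := hlin.add (((hbar.add hent).sub_const (hybridPsi K η x')).sub hgrad)
  refine (key.congr_deriv ?_).congr_of_eventuallyEq (Filter.Eventually.of_forall fun t => ?_)
  · simp only [Finset.mul_sum, ← Finset.sum_add_distrib, ← Finset.sum_sub_distrib]
    refine Finset.sum_congr rfl fun i _ => ?_
    have := (hx i).ne'
    simp only [hybridGradPsi, zero_mul, add_zero]
    field_simp
    ring
  · simp [hybridBreg, hybridPsi]

/-- First-order optimality for a minimizer over the open simplex: the gradient of the objective
is orthogonal to every direction tangent to the simplex. -/
theorem sum_mul_gradient_eq_zero_of_minimizer {K : ℕ} {η : ℝ} {b x' x : Fin K → ℝ}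
    (hx : posSimplex K x)
    (hmin : ∀ z, posSimplex K z →
      (∑ i, x i * b i) + hybridBreg K η x x' ≤ (∑ i, z i * b i) + hybridBreg K η z x')
    {d : Fin K → ℝ} (hd : ∑ i, d i = 0) :
    ∑ i, d i * (b i + hybridGradPsi K η x i - hybridGradPsi K η x' i) = 0 := by
  refine IsLocalMin.hasDerivAt_eq_zero ?_ (hasDerivAt_linear_add_hybridBreg K η b x' x d hx.1)
  have hpos : ∀ᶠ t : ℝ in nhds 0, ∀ i, 0 < x i + t * d i := by
    refine Filter.eventually_all.2 fun i => ?_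
    have hc : Continuous fun t : ℝ => x i + t * d i := by fun_prop
    exact hc.continuousAt.eventually (lt_mem_nhds (by simpa using hx.1 i))
  filter_upwards [hpos] with t ht
  simpa using hmin (fun i => x i + t * d i)
    ⟨ht, by rw [Finset.sum_add_distrib, ← Finset.mul_sum, hd, hx.2]; simp⟩

/-- The entropy part of the strong monotonicity of `∇ψ`. -/
theorem sq_sub_div_le_mul_sub_mul_log_sub {a c M : ℝ} (ha : 0 < a) (hc : 0 < c) (hM : 1 ≤ M)
    (hca : c ≤ M * a) :
    (a - c) ^ 2 / a ≤ M * ((a - c) * (Real.log a - Real.log c)) := by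
  rcases le_total a c with h | h
  · have hlog := Real.one_sub_inv_le_log_of_pos (div_pos hc ha)
    rw [Real.log_div hc.ne' ha.ne', inv_div] at hlog
    calc (a - c) ^ 2 / a ≤ M * ((c - a) * (1 - a / c)) := by
          rw [show M * ((c - a) * (1 - a / c)) = (a - c) ^ 2 * (M / c) by field_simp; ring,
            div_eq_mul_one_div]
          refine mul_le_mul_of_nonneg_left ?_ (sq_nonneg _)
          rw [div_le_div_iff₀ ha hc]
          linarith
      _ ≤ M * ((c - a) * (Real.log c - Real.log a)) := by
          have := sub_nonneg.2 h
          gcongr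
      _ = M * ((a - c) * (Real.log a - Real.log c)) := by ring
  · have hlog := Real.one_sub_inv_le_log_of_pos (div_pos ha hc)
    rw [Real.log_div ha.ne' hc.ne', inv_div] at hlog
    have hac := sub_nonneg.2 h
    calc (a - c) ^ 2 / a = 1 * ((a - c) * (1 - c / a)) := by field_simp
      _ ≤ M * ((a - c) * (Real.log a - Real.log c)) := by
          have : 0 ≤ 1 - c / a := sub_nonneg.2 ((div_le_one ha).2 h)
          gcongr

/-- Coordinatewise strong monotonicity of `∇ψ` relative to the Hessian at `x`. -/
theorem hybridHess_mul_sq_le {K : ℕ} {η M : ℝ} (hη : 0 < η) {x y : Fin K → ℝ} {i : Fin K}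
    (hx : 0 < x i) (hy : 0 < y i) (hM : 1 ≤ M) (hyx : y i ≤ M * x i) :
    hybridHess K η x i * (x i - y i) ^ 2 ≤
      M * ((x i - y i) * (hybridGradPsi K η x i - hybridGradPsi K η y i)) := by
  have hent := sq_sub_div_le_mul_sub_mul_log_sub hx hy hM hyx
  have hbar : (x i - y i) ^ 2 / x i ^ 2 ≤ M * ((x i - y i) * (1 / y i - 1 / x i)) := by
    rw [show M * ((x i - y i) * (1 / y i - 1 / x i)) = (x i - y i) ^ 2 * (M / (x i * y i)) by
      field_simp, div_eq_mul_one_div]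
    refine mul_le_mul_of_nonneg_left ?_ (sq_nonneg _)
    rw [div_le_div_iff₀ (by positivity) (by positivity)]
    nlinarith
  calc hybridHess K η x i * (x i - y i) ^ 2
      = 1 / η * ((x i - y i) ^ 2 / x i ^ 2 + K * ((x i - y i) ^ 2 / x i)) := by
        rw [hybridHess]; ring
    _ ≤ 1 / η * (M * ((x i - y i) * (1 / y i - 1 / x i)) +
          K * (M * ((x i - y i) * (Real.log (x i) - Real.log (y i))))) := by gcongr
    _ = _ := by simp only [hybridGradPsi]; ring

theorem hybridHess_pos {K : ℕ} {η : ℝ} (hη : 0 < η) {x : Fin K → ℝ} {i : Fin K}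
    (hx : 0 < x i) : 0 < hybridHess K η x i := by
  unfold hybridHess
  positivity

/-- A coordinate moves by a relative factor of at most the local norm of the displacement. -/
theorem le_one_add_sqrt_hessNormSq_mul {K : ℕ} {η : ℝ} (hη : 0 < η) (hη1 : η ≤ 1)
    {x y : Fin K → ℝ} (hx : ∀ i, 0 < x i) (i : Fin K) :
    y i ≤ (1 + Real.sqrt (hessNormSq K η x fun i => x i - y i)) * x i := by
  have hxi := hx i
  have hle : hybridHess K η x i * (x i - y i) ^ 2 ≤ hessNormSq K η x fun i => x i - y i :=
    Finset.single_le_sum (f := fun i => hybridHess K η x i * (x i - y i) ^ 2)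
      (fun j _ => mul_nonneg (hybridHess_pos hη (hx j)).le (sq_nonneg _)) (mem_univ i)
  have hh : 1 / x i ^ 2 ≤ hybridHess K η x i := by
    have h1 : 1 ≤ 1 / η := (one_le_div hη).2 hη1
    have h2 : 1 / x i ^ 2 ≤ 1 / x i ^ 2 + K / x i := le_add_of_nonneg_right (by positivity)
    exact h2.trans (le_mul_of_one_le_left (by positivity) h1)
  have hsq : ((y i - x i) / x i) ^ 2 ≤ hessNormSq K η x fun i => x i - y i := by
    calc ((y i - x i) / x i) ^ 2 = 1 / x i ^ 2 * (x i - y i) ^ 2 := by ring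
      _ ≤ hybridHess K η x i * (x i - y i) ^ 2 := by gcongr
      _ ≤ _ := hle
  have hdiv := (div_le_iff₀ hxi).1 (Real.le_sqrt_of_sq_le hsq)
  linarith

/-- Cauchy–Schwarz for the local norm and its dual. -/
theorem sum_mul_le_sqrt_hessNormSq_mul_sqrt_invHessNormSq {K : ℕ} {η : ℝ} (hη : 0 < η)
    {x : Fin K → ℝ} (hx : ∀ i, 0 < x i) (u v : Fin K → ℝ) :
    ∑ i, u i * v i ≤ Real.sqrt (hessNormSq K η x u) * Real.sqrt (invHessNormSq K η x v) := by
  have hpos (i : Fin K) : 0 < hybridHess K η x i := hybridHess_pos hη (hx i)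
  have hcs := Real.sum_mul_le_sqrt_mul_sqrt univ
    (fun i => Real.sqrt (hybridHess K η x i) * u i)
    (fun i => v i / Real.sqrt (hybridHess K η x i))
  simp only [mul_pow, div_pow, Real.sq_sqrt (hpos _).le] at hcs
  refine le_of_eq_of_le (Finset.sum_congr rfl fun i _ => ?_) hcs
  have := (Real.sqrt_pos.2 (hpos i)).ne'
  field_simp

/-- **Stability-term bound from the proof of Lemma 3 of the paper.**
If `x` and `y` are the mirror-descent outputs from the same point `x'` with loss
vectors `b₁` and `b₂`, and `‖b₂ − b₁‖_{∇⁻²ψ(x)} ≤ 1/9`, then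
`⟨x − y, b₂ − b₁⟩ ≤ 3‖b₂ − b₁‖²_{∇⁻²ψ(x)}`. -/
theorem omd_stability_term_bound
    (K : ℕ) (hK : 2 ≤ K) (η : ℝ) (hη : 0 < η) (hη' : η ≤ 1 / 162)
    (x' : Fin K → ℝ) (hx' : posSimplex K x')
    (b₁ b₂ : Fin K → ℝ)
    (x : Fin K → ℝ) (hx : posSimplex K x)
    (hxmin : ∀ z, posSimplex K z →
      (∑ i, x i * b₁ i) + hybridBreg K η x x' ≤ (∑ i, z i * b₁ i) + hybridBreg K η z x')
    (y : Fin K → ℝ) (hy : posSimplex K y)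
    (hymin : ∀ z, posSimplex K z →
      (∑ i, y i * b₂ i) + hybridBreg K η y x' ≤ (∑ i, z i * b₂ i) + hybridBreg K η z x')
    (hnorm : Real.sqrt (invHessNormSq K η x (fun i => b₂ i - b₁ i)) ≤ 1 / 9) :
    ∑ i, (x i - y i) * (b₂ i - b₁ i) ≤
      3 * invHessNormSq K η x (fun i => b₂ i - b₁ i) := by
  have hd : ∑ i, (x i - y i) = 0 := by rw [Finset.sum_sub_distrib, hx.2, hy.2, sub_self]
  have hgrad : ∑ i, (x i - y i) * (b₂ i - b₁ i) =
      ∑ i, (x i - y i) * (hybridGradPsi K η x i - hybridGradPsi K η y i) := by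
    have h := congrArg₂ (· - ·) (sum_mul_gradient_eq_zero_of_minimizer hx hxmin hd)
      (sum_mul_gradient_eq_zero_of_minimizer hy hymin hd)
    simp only [← Finset.sum_sub_distrib, sub_self] at h
    rw [← sub_eq_zero, ← Finset.sum_sub_distrib, ← neg_eq_zero, ← Finset.sum_neg_distrib, ← h]
    exact Finset.sum_congr rfl fun i _ => by ring
  have hcs := sum_mul_le_sqrt_hessNormSq_mul_sqrt_invHessNormSq hη hx.1
    (fun i => x i - y i) (fun i => b₂ i - b₁ i)
  have hCsq : Real.sqrt (invHessNormSq K η x fun i => b₂ i - b₁ i) ^ 2 =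
      invHessNormSq K η x fun i => b₂ i - b₁ i :=
    Real.sq_sqrt (Finset.sum_nonneg fun i _ =>
      div_nonneg (sq_nonneg _) (hybridHess_pos hη (hx.1 i)).le)
  have hUsq : Real.sqrt (hessNormSq K η x fun i => x i - y i) ^ 2 =
      hessNormSq K η x fun i => x i - y i :=
    Real.sq_sqrt (Finset.sum_nonneg fun i _ =>
      mul_nonneg (hybridHess_pos hη (hx.1 i)).le (sq_nonneg _))
  have hyx := le_one_add_sqrt_hessNormSq_mul (y := y) hη (by linarith) hx.1
  have hU := Real.sqrt_nonneg (hessNormSq K η x fun i => x i - y i)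
  have hC := Real.sqrt_nonneg (invHessNormSq K η x fun i => b₂ i - b₁ i)
  set U := Real.sqrt (hessNormSq K η x fun i => x i - y i)
  set C := Real.sqrt (invHessNormSq K η x fun i => b₂ i - b₁ i)
  have hmono : U ^ 2 ≤ (1 + U) * ∑ i, (x i - y i) * (b₂ i - b₁ i) := by
    rw [hUsq, hgrad, Finset.mul_sum]
    exact Finset.sum_le_sum fun i _ =>
      hybridHess_mul_sq_le hη (hx.1 i) (hy.1 i) (by linarith) (hyx i)
  have hUC : U ≤ 3 * C := by
    rcases hU.eq_or_lt with h0 | h0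
    · linarith
    · have h1 : U * U ≤ U * ((1 + U) * C) := by
        calc U * U = U ^ 2 := (sq U).symm
          _ ≤ (1 + U) * (U * C) := hmono.trans (by gcongr)
          _ = U * ((1 + U) * C) := by ring
      have h2 := le_of_mul_le_mul_left h1 h0
      nlinarith
  rw [← hCsq]
  nlinarith
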